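/- Let P = (1/2)P₁ + (1/2)P₂ with P₁, P₂ the self-similar measures as above (P₁ with maps x/3 and x/3+2/9; P₂ with maps x/4+1/2 and x/4+3/4), and let β = log 2 / log 3. Define F(n) = 2^{6n−4} + 2^{5n−4} and G(n) = 2^{6n−4} + 2^{6n−5} + 2^{5n−3}. Then lim_{n→∞} F(n)^{2/β} V_{F(n)}(P) = 1/144 and lim_{n→∞} G(n)^{2/β} V_{G(n)}(P) = (5/16)·3^{2 log 3/log 2 − 6}; since these limits differ, the sequence (n^{2/β} V_n(P)) does not converge, i.e., the β-dimensional quantization coefficient for P does not exist. -/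

import Mathlib

open MeasureTheory Set Filter Real
open scoped ENNReal

/-- Distortion error of a finite set of quantizers `γ` for the measure `P`. -/
noncomputable def distortion (P : Measure ℝ) (γ : Finset ℝ) : ℝ :=
  ∫ x, (⨅ c : γ, (x - (c : ℝ)) ^ 2) ∂P

/-- The `n`-th quantization error of `P`. -/
noncomputable def quantErr (P : Measure ℝ) (n : ℕ) : ℝ :=
  sInf {v : ℝ | ∃ γ : Finset ℝ, γ.Nonempty ∧ γ.card ≤ n ∧ v = distortion P γ}

/-- `γ` is an optimal set of `n`-means for `P`. -/
def IsOptimalSet (P : Measure ℝ) (n : ℕ) (γ : Finset ℝ) : Prop :=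
  γ.Nonempty ∧ γ.card ≤ n ∧ distortion P γ = quantErr P n

/-- Uniform distribution on `[a, b]`. -/
noncomputable def unif (a b : ℝ) : Measure ℝ :=
  (ENNReal.ofReal (b - a))⁻¹ • (volume.restrict (Icc a b))

/-- The uniform discrete measure on `{2/3, 5/6, 1}`. -/
noncomputable def discD : Measure ℝ :=
  (3 : ℝ≥0∞)⁻¹ • (Measure.dirac (2/3) + Measure.dirac (5/6) + Measure.dirac 1)

/-- Mixture `(1/2)P₁ + (1/2)P₂`. -/
noncomputable def mix (P₁ P₂ : Measure ℝ) : Measure ℝ :=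
  (2 : ℝ≥0∞)⁻¹ • P₁ + (2 : ℝ≥0∞)⁻¹ • P₂

/-- Squared distance from `x` to the nearest point of `γ`. -/
noncomputable def sqDist (γ : Finset ℝ) (x : ℝ) : ℝ := ⨅ c : γ, (x - (c : ℝ)) ^ 2

lemma sqDist_le {γ : Finset ℝ} {c : ℝ} (hc : c ∈ γ) (x : ℝ) : sqDist γ x ≤ (x - c) ^ 2 :=
  ciInf_le (f := fun c : γ => (x - (c : ℝ)) ^ 2) (Set.finite_range _).bddBelow ⟨c, hc⟩

lemma exists_sqDist_eq {γ : Finset ℝ} (hγ : γ.Nonempty) (x : ℝ) :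
    ∃ c ∈ γ, sqDist γ x = (x - c) ^ 2 := by
  have : Nonempty γ := hγ.to_subtype
  obtain ⟨c, hc⟩ := exists_eq_ciInf_of_finite (f := fun c : γ => (x - (c : ℝ)) ^ 2)
  exact ⟨c, c.2, hc.symm⟩

lemma sqDist_nonneg (γ : Finset ℝ) (x : ℝ) : 0 ≤ sqDist γ x :=
  Real.iInf_nonneg fun _ => sq_nonneg _

lemma continuous_sqDist {γ : Finset ℝ} (hγ : γ.Nonempty) : Continuous (sqDist γ) := by
  have : Nonempty γ := hγ.to_subtype
  have h : sqDist γ = fun x => Finset.univ.inf' Finset.univ_nonempty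
      (fun c : γ => (x - (c : ℝ)) ^ 2) := by
    funext x
    rw [Finset.inf'_univ_eq_ciInf]
    rfl
  rw [h]
  exact Continuous.finset_inf'_apply _ fun c _ => by fun_prop

lemma sqDist_anti {γ γ' : Finset ℝ} (hγ : γ.Nonempty) (h : γ ⊆ γ') (x : ℝ) :
    sqDist γ' x ≤ sqDist γ x := by
  obtain ⟨c, hc, e⟩ := exists_sqDist_eq hγ x
  exact e ▸ sqDist_le (h hc) x

lemma sqDist_image_affine {γ : Finset ℝ} (hγ : γ.Nonempty) (r t x : ℝ) :
    sqDist (γ.image fun c => r * c + t) (r * x + t) = r ^ 2 * sqDist γ x := by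
  apply le_antisymm
  · obtain ⟨c, hc, e⟩ := exists_sqDist_eq hγ x
    rw [e]
    refine (sqDist_le (Finset.mem_image_of_mem _ hc) _).trans_eq ?_
    ring
  · obtain ⟨c, hc, e⟩ := exists_sqDist_eq (hγ.image fun c => r * c + t) (r * x + t)
    obtain ⟨d, hd, rfl⟩ := Finset.mem_image.1 hc
    rw [e]
    calc r ^ 2 * sqDist γ x ≤ r ^ 2 * (x - d) ^ 2 := by gcongr; exact sqDist_le hd x
      _ = _ := by ring

/-- The properties of the mean with respect to the middle-third Cantor distribution
that determine its quantization error. -/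
structure IsCantorMean (I : (ℝ → ℝ) → ℝ) : Prop where
  mono : ∀ f g : ℝ → ℝ, Continuous f → Continuous g → (∀ x ∈ Icc (0 : ℝ) 1, f x ≤ g x) →
    I f ≤ I g
  smul : ∀ (r : ℝ) (f : ℝ → ℝ), I (fun x => r * f x) = r * I f
  selfSim : ∀ f : ℝ → ℝ, Continuous f →
    I f = (I (fun x => f (x / 3)) + I (fun x => f ((x + 2) / 3))) / 2
  quad : ∀ a b : ℝ, I (fun x => (a * x + b) ^ 2) = a ^ 2 / 8 + (a / 2 + b) ^ 2

namespace IsCantorMean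

variable {I : (ℝ → ℝ) → ℝ}

lemma quad_le (h : IsCantorMean I) {f : ℝ → ℝ} (hf : Continuous f) (a b : ℝ)
    (hab : ∀ x, 0 ≤ x → x ≤ 1 → (a * x + b) ^ 2 ≤ f x) :
    a ^ 2 / 8 + (a / 2 + b) ^ 2 ≤ I f := by
  rw [← h.quad]
  exact h.mono _ _ (by fun_prop) hf fun x hx => hab x hx.1 hx.2

lemma nonneg (h : IsCantorMean I) {f : ℝ → ℝ} (hf : Continuous f) (h0 : ∀ x, 0 ≤ f x) :
    0 ≤ I f := by
  simpa using h.quad_le hf 0 0 (by simpa using fun x _ _ => h0 x)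

lemma reflect (h : IsCantorMean I) : IsCantorMean (fun f => I (fun x => f (1 - x))) where
  mono f g hf hg hfg := h.mono _ _ (by fun_prop) (by fun_prop) fun x hx =>
    hfg _ ⟨by linarith [hx.2], by linarith [hx.1]⟩
  smul r f := h.smul r _
  selfSim f hf := by
    rw [h.selfSim _ (by fun_prop), add_comm]
    congr 3 <;> funext x <;> congr 1 <;> ring
  quad a b := by
    have : (fun x : ℝ => (a * (1 - x) + b) ^ 2) = fun x => (-a * x + (a + b)) ^ 2 := by
      funext x; ring
    rw [this, h.quad]; ring

lemma sqDist_reflect {γ : Finset ℝ} (hγ : γ.Nonempty) (x : ℝ) :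
    sqDist (γ.image fun c => 1 - c) (1 - x) = sqDist γ x := by
  have := sqDist_image_affine hγ (-1) 1 x
  simpa [neg_add_eq_sub] using this

lemma sixteenth_le_of_le_half (h : IsCantorMean I) {f : ℝ → ℝ} (hf : Continuous f)
    (h0 : ∀ x, 0 ≤ f x) (H : ∀ x, 0 ≤ x → x ≤ 1 → ∃ c ≤ (1 / 2 : ℝ), (x - c) ^ 2 ≤ f x) :
    1 / 16 ≤ I f := by
  rw [h.selfSim f hf]
  have h1 : 0 ≤ I (fun x => f (x / 3)) := h.nonneg (by fun_prop) fun x => h0 _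
  have h2 := h.quad_le (f := fun x => f ((x + 2) / 3)) (by fun_prop) (1 / 3) (1 / 6)
    fun x hx hx1 => by
      obtain ⟨c, hc, e⟩ := H ((x + 2) / 3) (by linarith) (by linarith)
      refine le_trans ?_ e
      apply pow_le_pow_left₀ <;> linarith
  norm_num at h2 ⊢
  linarith

lemma sixteenth_le_of_half_le (h : IsCantorMean I) {f : ℝ → ℝ} (hf : Continuous f)
    (h0 : ∀ x, 0 ≤ f x) (H : ∀ x, 0 ≤ x → x ≤ 1 → ∃ c, (1 / 2 : ℝ) ≤ c ∧ (x - c) ^ 2 ≤ f x) :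
    1 / 16 ≤ I f := by
  have := h.reflect.sixteenth_le_of_le_half (f := fun x => f (1 - x)) (by fun_prop)
    (fun x => h0 _) fun x hx hx1 => by
      obtain ⟨c, hc, e⟩ := H (1 - x) (by linarith) (by linarith)
      exact ⟨1 - c, by linarith, le_trans (le_of_eq (by ring)) e⟩
  simpa using this

/-- A one-point bound on the left half, robust against far-away points. -/
lemma left_le_of_near (h : IsCantorMean I) {f : ℝ → ℝ} (hf : Continuous f) {a : ℝ}
    (ha : a ≤ 1 / 3)
    (H : ∀ x, 0 ≤ x → x ≤ 1 → (x - a) ^ 2 ≤ f x ∨ ∃ b, 2 / 3 ≤ b ∧ (x - b) ^ 2 ≤ f x) :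
    1 / 72 ≤ I (fun x => f (x / 3)) := by
  have := h.quad_le (f := fun x => f (x / 3)) (by fun_prop) (1 / 3) (-max a 0)
    fun x hx hx1 => by
      rcases H (x / 3) (by linarith) (by linarith) with e | ⟨b, hb, e⟩ <;> refine le_trans ?_ e <;>
      rcases max_cases a 0 with ⟨e1, e2⟩ | ⟨e1, e2⟩ <;> rw [e1] <;> nlinarith
  nlinarith [sq_nonneg ((1 / 3 : ℝ) / 2 + -max a 0)]

lemma two_point (h : IsCantorMean I) {f : ℝ → ℝ} (hf : Continuous f) {a b : ℝ}
    (ha : a ≤ 1 / 2) (hb : 1 / 2 ≤ b) (h0 : ∀ x, 0 ≤ f x)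
    (H : ∀ x, 0 ≤ x → x ≤ 1 → (x - a) ^ 2 ≤ f x ∨ (x - b) ^ 2 ≤ f x) : 1 / 72 ≤ I f := by
  have hs := h.selfSim f hf
  have hL : 0 ≤ I (fun x => f (x / 3)) := h.nonneg (by fun_prop) fun x => h0 _
  have hR : 0 ≤ I (fun x => f ((x + 2) / 3)) := h.nonneg (by fun_prop) fun x => h0 _
  rcases lt_or_ge b (2 / 3) with hb' | hb'
  · have := h.quad_le (f := fun x => f ((x + 2) / 3)) (by fun_prop) (1 / 3) 0
      fun x hx hx1 => by
        rcases H ((x + 2) / 3) (by linarith) (by linarith) with e | e <;> refine le_trans ?_ e <;>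
        apply pow_le_pow_left₀ <;> linarith
    norm_num at this
    linarith
  rcases lt_or_ge (1 / 3) a with ha' | ha'
  · have := h.quad_le (f := fun x => f (x / 3)) (by fun_prop) (1 / 3) (-1 / 3)
      fun x hx hx1 => by
        rcases H (x / 3) (by linarith) (by linarith) with e | e <;> refine le_trans ?_ e <;> nlinarith
    norm_num at this
    linarith
  have h1 := h.left_le_of_near hf ha' fun x hx hx1 => (H x hx hx1).imp id fun e => ⟨b, hb', e⟩
  have h2 := h.reflect.left_le_of_near (f := fun x => f (1 - x)) (a := 1 - b) (by fun_prop)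
    (by linarith) fun x hx hx1 => (H (1 - x) (by linarith) (by linarith)).symm.imp
      (fun e => le_trans (le_of_eq (by ring)) e)
      fun e => ⟨1 - a, by linarith, le_trans (le_of_eq (by ring)) e⟩
  have e : (fun x : ℝ => f (1 - (1 - x) / 3)) = fun x => f ((x + 2) / 3) := by
    funext x; congr 1; ring
  simp only [e] at h2
  linarith

lemma two_point' (h : IsCantorMean I) {f : ℝ → ℝ} (hf : Continuous f) (a b : ℝ)
    (h0 : ∀ x, 0 ≤ f x)
    (H : ∀ x, 0 ≤ x → x ≤ 1 → (x - a) ^ 2 ≤ f x ∨ (x - b) ^ 2 ≤ f x) : 1 / 72 ≤ I f := by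
  rcases le_total a (1 / 2) with ha | ha <;> rcases le_total b (1 / 2) with hb | hb
  · have := h.sixteenth_le_of_le_half hf h0 fun x hx hx1 =>
      (H x hx hx1).elim (fun e => ⟨a, ha, e⟩) fun e => ⟨b, hb, e⟩
    linarith
  · exact h.two_point hf ha hb h0 H
  · exact h.two_point hf hb ha h0 fun x hx hx1 => (H x hx hx1).symm
  · have := h.sixteenth_le_of_half_le hf h0 fun x hx hx1 =>
      (H x hx hx1).elim (fun e => ⟨a, ha, e⟩) fun e => ⟨b, hb, e⟩
    linarith

lemma selfSim₂_right (h : IsCantorMean I) {f : ℝ → ℝ} (hf : Continuous f) :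
    I f = I (fun x => f (x / 3)) / 2 + I (fun x => f ((x + 6) / 9)) / 4 +
      I (fun x => f ((x + 8) / 9)) / 4 := by
  rw [h.selfSim f hf, h.selfSim (fun x => f ((x + 2) / 3)) (by fun_prop)]
  have e1 : (fun x : ℝ => f ((x / 3 + 2) / 3)) = fun x => f ((x + 6) / 9) := by
    funext x; congr 1; ring
  have e2 : (fun x : ℝ => f (((x + 2) / 3 + 2) / 3)) = fun x => f ((x + 8) / 9) := by
    funext x; congr 1; ring
  simp only [e1, e2]
  ring

lemma selfSim₃_right (h : IsCantorMean I) {f : ℝ → ℝ} (hf : Continuous f) :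
    I f = I (fun x => f (x / 3)) / 2 + I (fun x => f ((x + 6) / 9)) / 4 +
      I (fun x => f ((x + 24) / 27)) / 8 + I (fun x => f ((x + 26) / 27)) / 8 := by
  rw [h.selfSim₂_right hf, h.selfSim (fun x => f ((x + 8) / 9)) (by fun_prop)]
  have e1 : (fun x : ℝ => f ((x / 3 + 8) / 9)) = fun x => f ((x + 24) / 27) := by
    funext x; congr 1; ring
  have e2 : (fun x : ℝ => f (((x + 2) / 3 + 8) / 9)) = fun x => f ((x + 26) / 27) := by
    funext x; congr 1; ring
  simp only [e1, e2]
  ring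

lemma selfSim₂_left (h : IsCantorMean I) {f : ℝ → ℝ} (hf : Continuous f) :
    I f = I (fun x => f (x / 9)) / 4 + I (fun x => f ((x + 2) / 9)) / 4 +
      I (fun x => f ((x + 2) / 3)) / 2 := by
  rw [h.selfSim f hf, h.selfSim (fun x => f (x / 3)) (by fun_prop)]
  have e1 : (fun x : ℝ => f (x / 3 / 3)) = fun x => f (x / 9) := by
    funext x; congr 1; ring
  have e2 : (fun x : ℝ => f ((x + 2) / 3 / 3)) = fun x => f ((x + 2) / 9) := by
    funext x; congr 1; ring
  simp only [e1, e2]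
  ring

lemma ninth_le (h : IsCantorMean I) {f : ℝ → ℝ} (hf : Continuous f) {a : ℝ} (ha : a ≤ 1)
    (H : ∀ x, x ≤ 1 → (x - a) ^ 2 ≤ f x ∨ (3 / 2 - x) ^ 2 ≤ f x) : 1 / 9 ≤ I f := by
  rcases le_total (1 / 2) a with ha' | ha'
  · have := h.quad_le hf 1 (-a) fun x hx hx1 => by
      rcases H x hx1 with e | e <;> refine le_trans ?_ e <;> nlinarith
    nlinarith [sq_nonneg ((1 : ℝ) / 2 + -a)]
  rw [h.selfSim₃_right hf]
  rcases le_total a (19 / 54) with ha'' | ha''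
  · have h1 := h.quad_le (f := fun x => f (x / 3)) (by fun_prop) (1 / 3) (-max a 0)
      fun x hx hx1 => by
        rcases H (x / 3) (by linarith) with e | e <;> refine le_trans ?_ e <;>
        rcases max_cases a 0 with ⟨e1, e2⟩ | ⟨e1, e2⟩ <;> rw [e1] <;> nlinarith
    have h2 := h.quad_le (f := fun x => f ((x + 6) / 9)) (by fun_prop) (1 / 9) (2 / 3 - 19 / 54)
      fun x hx hx1 => by
        rcases H ((x + 6) / 9) (by linarith) with e | e <;> refine le_trans ?_ e <;>
        apply pow_le_pow_left₀ <;> linarith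
    have h3 := h.quad_le (f := fun x => f ((x + 24) / 27)) (by fun_prop) (1 / 27)
      (24 / 27 - 19 / 54) fun x hx hx1 => by
        rcases H ((x + 24) / 27) (by linarith) with e | e <;> refine le_trans ?_ e <;>
        apply pow_le_pow_left₀ <;> linarith
    have h4 := h.quad_le (f := fun x => f ((x + 26) / 27)) (by fun_prop) (1 / 27)
      (- 29 / 54) fun x hx hx1 => by
        rcases H ((x + 26) / 27) (by linarith) with e | e <;> refine le_trans ?_ e <;>
        nlinarith
    have := sq_nonneg ((1 / 3 : ℝ) / 2 + -max a 0)
    norm_num at h2 h3 h4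
    linarith
  · have h1 := h.quad_le (f := fun x => f (x / 3)) (by fun_prop) (1 / 3) (-a)
      fun x hx hx1 => by
        rcases H (x / 3) (by linarith) with e | e <;> refine le_trans ?_ e <;> nlinarith
    have h2 := h.quad_le (f := fun x => f ((x + 6) / 9)) (by fun_prop) (1 / 9) (2 / 3 - a)
      fun x hx hx1 => by
        rcases H ((x + 6) / 9) (by linarith) with e | e <;> refine le_trans ?_ e <;>
        apply pow_le_pow_left₀ <;> linarith
    have h3 := h.quad_le (f := fun x => f ((x + 24) / 27)) (by fun_prop) (1 / 27)
      (24 / 27 - a) fun x hx hx1 => by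
        rcases H ((x + 24) / 27) (by linarith) with e | e <;> refine le_trans ?_ e <;>
        apply pow_le_pow_left₀ <;> linarith
    have h4 := h.quad_le (f := fun x => f ((x + 26) / 27)) (by fun_prop) (1 / 27)
      (26 / 27 - 1 / 2) fun x hx hx1 => by
        rcases H ((x + 26) / 27) (by linarith) with e | e <;> refine le_trans ?_ e <;>
        apply pow_le_pow_left₀ <;> linarith
    norm_num at h4
    nlinarith [sq_nonneg (a - 163 / 378)]

lemma thirtysixth_le (h : IsCantorMean I) {f : ℝ → ℝ} (hf : Continuous f) {c : ℝ}
    (h0 : ∀ x, 0 ≤ f x)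
    (H : ∀ x, 0 ≤ x → x ^ 2 ≤ f x ∨ (x - c) ^ 2 ≤ f x) : 1 / 36 ≤ I f := by
  rcases le_total c (1 / 2) with hc | hc
  · have hs := h.selfSim f hf
    have hL : 0 ≤ I (fun x => f (x / 3)) := h.nonneg (by fun_prop) fun x => h0 _
    have := h.quad_le (f := fun x => f ((x + 2) / 3)) (by fun_prop) (1 / 3) (1 / 6)
      fun x hx hx1 => by
        rcases H ((x + 2) / 3) (by linarith) with e | e <;> refine le_trans ?_ e <;>
        apply pow_le_pow_left₀ <;> linarith
    norm_num at this
    linarith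
  rcases le_total c (2 / 3) with hc' | hc'
  · have hs := h.selfSim₂_left hf
    have hL : 0 ≤ I (fun x => f (x / 9)) := h.nonneg (by fun_prop) fun x => h0 _
    have h1 := h.quad_le (f := fun x => f ((x + 2) / 9)) (by fun_prop) 0 (1 / 6)
      fun x hx hx1 => by
        rcases H ((x + 2) / 9) (by linarith) with e | e <;> refine le_trans ?_ e <;> nlinarith
    have h2 := h.quad_le (f := fun x => f ((x + 2) / 3)) (by fun_prop) (1 / 3) 0
      fun x hx hx1 => by
        rcases H ((x + 2) / 3) (by linarith) with e | e <;> refine le_trans ?_ e <;>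
        apply pow_le_pow_left₀ <;> linarith
    norm_num at h1 h2
    linarith
  · have hs := h.selfSim f hf
    have h1 := h.quad_le (f := fun x => f (x / 3)) (by fun_prop) (1 / 3) 0
      fun x hx hx1 => by
        rcases H (x / 3) (by linarith) with e | e <;> refine le_trans ?_ e <;> nlinarith
    have h2 := h.quad_le (f := fun x => f ((x + 2) / 3)) (by fun_prop) (1 / 3) (2 / 3 - min c 1)
      fun x hx hx1 => by
        rcases H ((x + 2) / 3) (by linarith) with e | e <;> refine le_trans ?_ e <;>
        rcases min_cases c 1 with ⟨e1, e2⟩ | ⟨e1, e2⟩ <;> rw [e1] <;> nlinarith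
    have := sq_nonneg ((1 / 3 : ℝ) / 2 + (2 / 3 - min c 1))
    norm_num at h1
    linarith

lemma three_point (h : IsCantorMean I) {f : ℝ → ℝ} (hf : Continuous f) {a b c : ℝ}
    (ha : a ≤ 1 / 2) (hb : 1 / 2 ≤ b) (hbc : b ≤ c) (h0 : ∀ x, 0 ≤ f x)
    (H : ∀ x, (x - a) ^ 2 ≤ f x ∨ (x - b) ^ 2 ≤ f x ∨ (x - c) ^ 2 ≤ f x) :
    5 / 648 ≤ I f := by
  have hs := h.selfSim f hf
  have hR : 0 ≤ I (fun x => f ((x + 2) / 3)) := h.nonneg (by fun_prop) fun x => h0 _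
  rcases lt_or_ge (1 / 3) a with ha' | ha'
  · have := h.quad_le (f := fun x => f (x / 3)) (by fun_prop) (1 / 3) (-1 / 3)
      fun x hx hx1 => by
        rcases H (x / 3) with e | e | e <;> refine le_trans ?_ e <;> nlinarith
    norm_num at this
    linarith
  rcases lt_or_ge b (2 / 3) with hb' | hb'
  · have h1 := h.ninth_le (f := fun x => 9 * f (x / 3)) (a := 3 * a) (by fun_prop) (by linarith)
      fun x hx => by
        rcases H (x / 3) with e | e | e
        · left; linarith
        · right; nlinarith
        · right; nlinarith
    have h2 := h.thirtysixth_le (f := fun x => 9 * f ((x + 2) / 3)) (c := 3 * c - 2)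
      (by fun_prop) (fun x => by linarith [h0 ((x + 2) / 3)]) fun x hx => by
        rcases H ((x + 2) / 3) with e | e | e
        · left; nlinarith
        · left; nlinarith
        · right; linarith
    rw [h.smul] at h1 h2
    linarith
  · have h1 := h.left_le_of_near hf ha' fun x _ _ => (H x).imp id fun e =>
      e.elim (fun e => ⟨b, hb', e⟩) fun e => ⟨c, by linarith, e⟩
    have h2 := h.two_point' (f := fun x => 9 * f ((x + 2) / 3)) (by fun_prop)
      (min (3 * b - 2) 1) (min (3 * c - 2) 1) (fun x => by linarith [h0 ((x + 2) / 3)])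
      fun x hx hx1 => by
        rcases H ((x + 2) / 3) with e | e | e
        · left
          rcases min_cases (3 * b - 2) 1 with ⟨e1, e2⟩ | ⟨e1, e2⟩ <;> rw [e1] <;> nlinarith
        · left
          rcases min_cases (3 * b - 2) 1 with ⟨e1, e2⟩ | ⟨e1, e2⟩ <;> rw [e1] <;> nlinarith
        · right
          rcases min_cases (3 * c - 2) 1 with ⟨e1, e2⟩ | ⟨e1, e2⟩ <;> rw [e1] <;> nlinarith
    rw [h.smul] at h2
    linarith

lemma left_of_mem (h : IsCantorMean I) {γ A : Finset ℝ} (hγ : γ.Nonempty) {a : ℝ} (haA : a ∈ A)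
    (ha : 1 / 6 ≤ a) (ha' : a ≤ 1 / 2) (H : ∀ c ∈ γ, c ∈ A ∨ 1 / 2 ≤ c) :
    I (sqDist (A.image fun c => 3 * c)) / 9 ≤ I (fun x => sqDist γ (x / 3)) := by
  have hA : A.Nonempty := ⟨a, haA⟩
  have cγ := continuous_sqDist hγ
  have key : I (sqDist (A.image fun c => 3 * c)) ≤ I (fun x => 9 * sqDist γ (x / 3)) := by
    refine h.mono _ _ (continuous_sqDist (hA.image _)) (by fun_prop) fun x hx => ?_
    have e := sqDist_image_affine hA 3 0 (x / 3)
    simp only [add_zero] at e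
    rw [mul_div_cancel₀ x (by norm_num : (3 : ℝ) ≠ 0)] at e
    rw [e]
    have : sqDist A (x / 3) ≤ sqDist γ (x / 3) := by
      obtain ⟨c, hc, e⟩ := exists_sqDist_eq hγ (x / 3)
      rw [e]
      rcases H c hc with hcA | hc'
      · exact sqDist_le hcA _
      · refine (sqDist_le haA _).trans ?_
        nlinarith [hx.1, hx.2]
    linarith
  rw [h.smul] at key
  linarith

lemma left_of_far (h : IsCantorMean I) {γ : Finset ℝ} (hγ : γ.Nonempty)
    (H : ∀ c ∈ γ, c ≤ 1 / 6 ∨ 1 / 2 ≤ c) : 1 / 144 ≤ I (fun x => sqDist γ (x / 3)) := by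
  have cγ := continuous_sqDist hγ
  rw [h.selfSim _ (by fun_prop)]
  have h1 : 0 ≤ I (fun x => sqDist γ (x / 3 / 3)) :=
    h.nonneg (by fun_prop) fun x => sqDist_nonneg _ _
  have h2 := h.quad_le (f := fun x => sqDist γ ((x + 2) / 3 / 3)) (by fun_prop) (1 / 9) (1 / 18)
    fun x hx hx1 => by
      obtain ⟨c, hc, e⟩ := exists_sqDist_eq hγ ((x + 2) / 3 / 3)
      simp only [e]
      rcases H c hc with hc | hc <;> nlinarith
  norm_num at h2
  linarith

lemma right_of_mem (h : IsCantorMean I) {γ A : Finset ℝ} (hγ : γ.Nonempty) {a : ℝ} (haA : a ∈ A)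
    (ha : a ≤ 5 / 6) (ha' : 1 / 2 ≤ a) (H : ∀ c ∈ γ, c ∈ A ∨ c ≤ 1 / 2) :
    I (sqDist (A.image fun c => 3 * c - 2)) / 9 ≤ I (fun x => sqDist γ ((x + 2) / 3)) := by
  have := h.reflect.left_of_mem (hγ.image fun c => 1 - c) (A := A.image fun c => 1 - c)
    (Finset.mem_image_of_mem _ haA) (by linarith) (by linarith) fun c hc => by
      obtain ⟨d, hd, rfl⟩ := Finset.mem_image.1 hc
      exact (H d hd).imp (Finset.mem_image_of_mem _) fun h => by linarith
  have e1 : (fun x => sqDist (γ.image fun c => 1 - c) ((1 - x) / 3)) =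
      fun x => sqDist γ ((x + 2) / 3) := by
    funext x
    rw [← sqDist_reflect hγ]
    congr 1; ring
  have e2 : (fun x => sqDist ((A.image fun c => 1 - c).image fun c => 3 * c) (1 - x)) =
      sqDist (A.image fun c => 3 * c - 2) := by
    funext x
    rw [← sqDist_reflect ((Finset.Nonempty.image ⟨a, haA⟩ _)), Finset.image_image,
      Finset.image_image]
    congr 2
    funext c
    simp only [Function.comp]
    ring
  simpa only [e1, e2] using this

lemma right_of_far (h : IsCantorMean I) {γ : Finset ℝ} (hγ : γ.Nonempty)
    (H : ∀ c ∈ γ, 5 / 6 ≤ c ∨ c ≤ 1 / 2) : 1 / 144 ≤ I (fun x => sqDist γ ((x + 2) / 3)) := by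
  have := h.reflect.left_of_far (hγ.image fun c => 1 - c) fun c hc => by
    obtain ⟨d, hd, rfl⟩ := Finset.mem_image.1 hc
    exact (H d hd).imp (fun h => by linarith) fun h => by linarith
  have e1 : (fun x => sqDist (γ.image fun c => 1 - c) ((1 - x) / 3)) =
      fun x => sqDist γ ((x + 2) / 3) := by
    funext x
    rw [← sqDist_reflect hγ]
    congr 1; ring
  simpa only [e1] using this

lemma card_one_bound (h : IsCantorMean I) {γ : Finset ℝ} (hc : γ.card = 1) :
    1 / 8 ≤ I (sqDist γ) := by
  obtain ⟨a, rfl⟩ := Finset.card_eq_one.1 hc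
  have := h.quad_le (continuous_sqDist (Finset.singleton_nonempty a)) 1 (-a) fun x _ _ => by
    obtain ⟨c, hc, e⟩ := exists_sqDist_eq (Finset.singleton_nonempty a) x
    obtain rfl := Finset.mem_singleton.1 hc
    exact e ▸ le_of_eq (by ring)
  nlinarith [sq_nonneg ((1 : ℝ) / 2 + -a)]

lemma card_two_bound (h : IsCantorMean I) {γ : Finset ℝ} (hc : γ.card = 2) :
    1 / 72 ≤ I (sqDist γ) := by
  have hγ : γ.Nonempty := Finset.card_pos.1 (by omega)
  obtain ⟨a, b, -, rfl⟩ := Finset.card_eq_two.1 hc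
  refine h.two_point' (continuous_sqDist hγ) a b (sqDist_nonneg _) fun x _ _ => ?_
  obtain ⟨c, hc, e⟩ := exists_sqDist_eq hγ x
  rw [e]
  rcases Finset.mem_insert.1 hc with rfl | hc
  · exact Or.inl le_rfl
  · exact Or.inr (Finset.mem_singleton.1 hc ▸ le_rfl)

lemma sixteenth_le_of_forall_le (h : IsCantorMean I) {γ : Finset ℝ} (hγ : γ.Nonempty)
    (H : ∀ c ∈ γ, c ≤ 1 / 2) : 1 / 16 ≤ I (sqDist γ) :=
  h.sixteenth_le_of_le_half (continuous_sqDist hγ) (sqDist_nonneg _) fun x _ _ =>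
    let ⟨c, hc, e⟩ := exists_sqDist_eq hγ x
    ⟨c, H c hc, e.ge⟩

lemma sixteenth_le_of_forall_ge (h : IsCantorMean I) {γ : Finset ℝ} (hγ : γ.Nonempty)
    (H : ∀ c ∈ γ, 1 / 2 ≤ c) : 1 / 16 ≤ I (sqDist γ) :=
  h.sixteenth_le_of_half_le (continuous_sqDist hγ) (sqDist_nonneg _) fun x _ _ =>
    let ⟨c, hc, e⟩ := exists_sqDist_eq hγ x
    ⟨c, H c hc, e.ge⟩

lemma card_three_bound (h : IsCantorMean I) {γ : Finset ℝ} (hc : γ.card = 3) :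
    5 / 648 ≤ I (sqDist γ) := by
  have hγ : γ.Nonempty := Finset.card_pos.1 (by omega)
  obtain ⟨a, b, c, hab, hbc, H⟩ : ∃ a b c : ℝ, a ≤ b ∧ b ≤ c ∧ ∀ d ∈ γ, d = a ∨ d = b ∨ d = c := by
    refine ⟨γ.orderEmbOfFin hc 0, γ.orderEmbOfFin hc 1, γ.orderEmbOfFin hc 2,
      (γ.orderEmbOfFin hc).monotone (by decide), (γ.orderEmbOfFin hc).monotone (by decide),
      fun d hd => ?_⟩
    have : d ∈ Set.range (γ.orderEmbOfFin hc) := by simpa using hd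
    obtain ⟨i, rfl⟩ := this
    fin_cases i <;> simp
  have hf := continuous_sqDist hγ
  have H' : ∀ x, (x - a) ^ 2 ≤ sqDist γ x ∨ (x - b) ^ 2 ≤ sqDist γ x ∨
      (x - c) ^ 2 ≤ sqDist γ x := fun x => by
    obtain ⟨d, hd, e⟩ := exists_sqDist_eq hγ x
    rw [e]
    rcases H d hd with rfl | rfl | rfl <;> simp
  rcases lt_or_ge (1 / 2) a with ha | ha
  · have := h.sixteenth_le_of_forall_ge hγ fun d hd => by
      rcases H d hd with rfl | rfl | rfl <;> linarith
    linarith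
  rcases lt_or_ge c (1 / 2) with hc' | hc'
  · have := h.sixteenth_le_of_forall_le hγ fun d hd => by
      rcases H d hd with rfl | rfl | rfl <;> linarith
    linarith
  rcases le_total (1 / 2) b with hb | hb
  · exact h.three_point hf ha hb hbc (sqDist_nonneg _) H'
  · have := h.reflect.three_point (f := fun x => sqDist γ (1 - x)) (a := 1 - c) (b := 1 - b)
      (c := 1 - a) (by fun_prop) (by linarith) (by linarith) (by linarith)
      (fun x => sqDist_nonneg _ _) fun x => by
        rcases H' (1 - x) with e | e | e
        · exact Or.inr (Or.inr (le_trans (le_of_eq (by ring)) e))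
        · exact Or.inr (Or.inl (le_trans (le_of_eq (by ring)) e))
        · exact Or.inl (le_trans (le_of_eq (by ring)) e)
    simpa using this

/-- The quantization error of the Cantor distribution lies above the line through its values
at `2 ^ k` and `2 ^ (k + 1)` points. -/
theorem lower_bound (k : ℕ) : ∀ {I : (ℝ → ℝ) → ℝ}, IsCantorMean I → ∀ γ : Finset ℝ, γ.Nonempty →
    (1 / 9) ^ k / 72 * (17 - 8 * γ.card / 2 ^ k) ≤ I (sqDist γ) := by
  induction k with
  | zero =>
    intro I h γ hγ
    have h0 : 0 ≤ I (sqDist γ) := h.nonneg (continuous_sqDist hγ) (sqDist_nonneg γ)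
    have hpos := Finset.card_pos.2 hγ
    have h1 : γ.card = 1 ∨ γ.card = 2 ∨ 3 ≤ γ.card := by omega
    rcases h1 with e | e | e
    · have := h.card_one_bound e
      rw [e]; norm_num; linarith
    · have := h.card_two_bound e
      rw [e]; norm_num; linarith
    · have : (3 : ℝ) ≤ γ.card := by exact_mod_cast e
      norm_num; linarith
  | succ k ih =>
    intro I h γ hγ
    have cγ := continuous_sqDist hγ
    set T : ℝ := (1 / 9) ^ (k + 1) / 72 * (17 - 8 * γ.card / 2 ^ (k + 1)) with hT
    have hT17 : T ≤ 17 / 648 := by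
      have a1 : ((1 : ℝ) / 9) ^ (k + 1) ≤ 1 / 9 := by
        rw [pow_succ]
        have : ((1 : ℝ) / 9) ^ k ≤ 1 := pow_le_one₀ (by norm_num) (by norm_num)
        linarith
      have a2 : (0 : ℝ) ≤ 8 * γ.card / 2 ^ (k + 1) := by positivity
      have a3 : (0 : ℝ) ≤ (1 / 9) ^ (k + 1) := by positivity
      rw [hT]; nlinarith
    have hTk : (k = 0 ∧ T = 1 / 648 * (17 - 4 * γ.card)) ∨ T ≤ 17 / 5832 := by
      rcases k with _ | k
      · left; refine ⟨rfl, ?_⟩; rw [hT]; norm_num; ring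
      · right
        have a1 : ((1 : ℝ) / 9) ^ (k + 1 + 1) ≤ 1 / 81 := by
          rw [pow_succ, pow_succ]
          have : ((1 : ℝ) / 9) ^ k ≤ 1 := pow_le_one₀ (by norm_num) (by norm_num)
          linarith
        have a2 : (0 : ℝ) ≤ 8 * γ.card / 2 ^ (k + 1 + 1) := by positivity
        have a3 : (0 : ℝ) ≤ (1 / 9) ^ (k + 1 + 1) := by positivity
        rw [hT]; nlinarith
    have hpos := Finset.card_pos.2 hγ
    have h1 : γ.card = 1 ∨ γ.card = 2 ∨ γ.card = 3 ∨ 4 ≤ γ.card := by omega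
    rcases h1 with e | e | e | e
    · have := h.card_one_bound e
      linarith
    · have := h.card_two_bound e
      rw [e] at hTk
      rcases hTk with ⟨-, h2⟩ | h2 <;> norm_num at h2 <;> linarith
    · have := h.card_three_bound e
      rw [e] at hTk
      rcases hTk with ⟨-, h2⟩ | h2 <;> norm_num at h2 <;> linarith
    have e4 : (4 : ℝ) ≤ γ.card := by exact_mod_cast e
    have hT288 : T ≤ 1 / 288 := by rcases hTk with ⟨-, h2⟩ | h2 <;> linarith
    set A := γ.filter (fun c => c < 1 / 2) with hA
    set B := γ.filter (fun c => ¬ c < 1 / 2) with hB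
    have hcard : A.card + B.card = γ.card := Finset.card_filter_add_card_filter_not _
    have hL : 0 ≤ I (fun x => sqDist γ (x / 3)) :=
      h.nonneg (by fun_prop) fun x => sqDist_nonneg _ _
    have hR : 0 ≤ I (fun x => sqDist γ ((x + 2) / 3)) :=
      h.nonneg (by fun_prop) fun x => sqDist_nonneg _ _
    have hs := h.selfSim _ cγ
    by_cases gA : ∃ a ∈ A, 1 / 6 ≤ a
    swap
    · push Not at gA
      have := h.left_of_far hγ fun c hc => by
        rcases lt_or_ge c (1 / 2) with hc' | hc'
        · exact Or.inl (gA c (Finset.mem_filter.2 ⟨hc, hc'⟩)).le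
        · exact Or.inr hc'
      linarith
    by_cases gB : ∃ a ∈ B, a ≤ 5 / 6
    swap
    · push Not at gB
      have := h.right_of_far hγ fun c hc => by
        rcases lt_or_ge c (1 / 2) with hc' | hc'
        · exact Or.inr hc'.le
        · exact Or.inl (gB c (Finset.mem_filter.2 ⟨hc, hc'.not_gt⟩)).le
      linarith
    obtain ⟨a, haA, ha⟩ := gA
    obtain ⟨b, hbB, hb⟩ := gB
    have h1 := h.left_of_mem hγ haA ha (Finset.mem_filter.1 haA).2.le fun c hc => by
      rcases lt_or_ge c (1 / 2) with hc' | hc'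
      · exact Or.inl (Finset.mem_filter.2 ⟨hc, hc'⟩)
      · exact Or.inr hc'
    have h2 := h.right_of_mem hγ hbB hb (not_lt.1 (Finset.mem_filter.1 hbB).2) fun c hc => by
      rcases lt_or_ge c (1 / 2) with hc' | hc'
      · exact Or.inr hc'.le
      · exact Or.inl (Finset.mem_filter.2 ⟨hc, hc'.not_gt⟩)
    have h3 := ih h (A.image fun c => 3 * c) (Finset.Nonempty.image ⟨a, haA⟩ _)
    have h4 := ih h (B.image fun c => 3 * c - 2) (Finset.Nonempty.image ⟨b, hbB⟩ _)
    rw [Finset.card_image_of_injective _ fun x y hxy => by simpa using hxy] at h3 h4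
    have hc' : (γ.card : ℝ) = A.card + B.card := by exact_mod_cast hcard.symm
    have hTe : T = ((1 / 9) ^ k / 72 * (17 - 8 * A.card / 2 ^ k) / 9 +
        (1 / 9) ^ k / 72 * (17 - 8 * B.card / 2 ^ k) / 9) / 2 := by
      rw [hT, hc', pow_succ, pow_succ]
      field_simp
      ring
    linarith

end IsCantorMean
/-- `P` can be quantized by at most `n` points with mean squared error at most `w`. -/
def Quantizable (P : Measure ℝ) (n : ℕ) (w : ℝ) : Prop :=
  ∃ γ : Finset ℝ, γ.Nonempty ∧ γ.card ≤ n ∧ ∫ x, sqDist γ x ∂P ≤ w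

lemma quantizable_one {P : Measure ℝ} (a : ℝ) : Quantizable P 1 (∫ x, (x - a) ^ 2 ∂P) := by
  refine ⟨{a}, Finset.singleton_nonempty a, by simp, le_of_eq ?_⟩
  congr 1
  funext x
  obtain ⟨c, hc, e⟩ := exists_sqDist_eq (Finset.singleton_nonempty a) x
  rw [e, Finset.mem_singleton.1 hc]

section SelfSimilar

variable {P : Measure ℝ} [IsProbabilityMeasure P] {ρ t₁ t₂ u v : ℝ}

lemma measure_compl_Icc_eq_zero_of_selfSimilar
    (hP : P = (2 : ℝ≥0∞)⁻¹ • P.map (fun x => ρ * x + t₁) +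
      (2 : ℝ≥0∞)⁻¹ • P.map (fun x => ρ * x + t₂))
    (hρ : 0 < ρ) (hρ1 : ρ < 1) (hu₁ : u ≤ ρ * u + t₁) (hu₂ : u ≤ ρ * u + t₂)
    (hv₁ : ρ * v + t₁ ≤ v) (hv₂ : ρ * v + t₂ ≤ v) : P (Icc u v)ᶜ = 0 := by
  set g : ℝ → ℝ := fun x => max (u - x) (x - v) with hg
  have mg : Measurable g := by fun_prop
  have mS : ∀ r, MeasurableSet {x | r < g x} := fun r => measurableSet_lt measurable_const mg
  have step : ∀ r, P {x | ρ * r < g x} ≤ P {x | r < g x} := fun r => by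
    have sub : ∀ t, u ≤ ρ * u + t → ρ * v + t ≤ v →
        (fun x => ρ * x + t) ⁻¹' {x | ρ * r < g x} ⊆ {x | r < g x} := fun t h1 h2 x hx => by
      simp only [hg, Set.mem_preimage, Set.mem_ofPred_eq, lt_max_iff] at hx ⊢
      rcases hx with hx | hx
      · left; nlinarith
      · right; nlinarith
    calc P {x | ρ * r < g x}
        = 2⁻¹ * P ((fun x => ρ * x + t₁) ⁻¹' {x | ρ * r < g x}) +
          2⁻¹ * P ((fun x => ρ * x + t₂) ⁻¹' {x | ρ * r < g x}) := by
          conv_lhs => rw [hP]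
          rw [Measure.add_apply, Measure.smul_apply, Measure.smul_apply,
            Measure.map_apply (by fun_prop) (mS _), Measure.map_apply (by fun_prop) (mS _)]
          rfl
      _ ≤ 2⁻¹ * P {x | r < g x} + 2⁻¹ * P {x | r < g x} := by
          gcongr
          · exact sub _ hu₁ hv₁
          · exact sub _ hu₂ hv₂
      _ = P {x | r < g x} := by
          rw [← add_mul, ENNReal.inv_two_add_inv_two, one_mul]
  have iter : ∀ (r : ℝ) (m : ℕ), P {x | r < g x} ≤ P {x | r / ρ ^ m < g x} := fun r m => by
    induction m with
    | zero => simp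
    | succ m ih =>
      refine ih.trans ((le_of_eq ?_).trans (step _))
      congr 3
      funext x
      rw [pow_succ]
      field_simp
  have zero : ∀ r, 0 < r → P {x | r < g x} = 0 := fun r hr => by
    have hlim : Tendsto (fun m : ℕ => r / ρ ^ m) atTop atTop := by
      have := (tendsto_pow_atTop_atTop_of_one_lt (one_lt_inv₀ hρ |>.2 hρ1)).const_mul_atTop hr
      simpa [div_eq_mul_inv] using this
    have hmono : Antitone fun m : ℕ => {x | r / ρ ^ m < g x} := fun a b hab x hx => by
      simp only [Set.mem_ofPred_eq] at hx ⊢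
      refine lt_of_le_of_lt ?_ hx
      exact div_le_div_of_nonneg_left hr.le (by positivity)
        (pow_le_pow_of_le_one hρ.le hρ1.le hab)
    have := tendsto_measure_iInter_atTop (μ := P) (fun m => (mS (r / ρ ^ m)).nullMeasurableSet)
      hmono ⟨0, measure_ne_top _ _⟩
    have hempty : ⋂ m : ℕ, {x | r / ρ ^ m < g x} = ∅ := by
      refine Set.eq_empty_of_forall_notMem fun x hx => ?_
      obtain ⟨m, hm⟩ := (hlim.eventually_ge_atTop (g x)).exists
      exact absurd (Set.mem_iInter.1 hx m) (not_lt.2 hm)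
    rw [hempty, measure_empty] at this
    exact le_antisymm (ge_of_tendsto' this (iter r)) bot_le
  have hcover : (Icc u v)ᶜ ⊆ ⋃ m : ℕ, {x | 1 / ((m : ℝ) + 1) < g x} := fun x hx => by
    have : 0 < g x := by
      simp only [Set.mem_compl_iff, Set.mem_Icc, not_and_or, not_le] at hx
      simp only [hg, lt_max_iff]
      exact hx.imp sub_pos.2 sub_pos.2
    obtain ⟨m, hm⟩ := exists_nat_one_div_lt this
    exact Set.mem_iUnion.2 ⟨m, hm⟩
  exact measure_mono_null hcover (measure_iUnion_null fun m => zero _ (by positivity))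

lemma integrable_of_continuous (hs : P (Icc u v)ᶜ = 0) {f : ℝ → ℝ} (hf : Continuous f) :
    Integrable f P := by
  have h : IntegrableOn f (Icc u v) P := hf.integrableOn_Icc
  have hae : ∀ᵐ x ∂P, x ∈ Icc u v := hs
  rwa [IntegrableOn, Measure.restrict_eq_self_of_ae_mem hae] at h

lemma integral_selfSimilar
    (hP : P = (2 : ℝ≥0∞)⁻¹ • P.map (fun x => ρ * x + t₁) +
      (2 : ℝ≥0∞)⁻¹ • P.map (fun x => ρ * x + t₂))
    (hs : P (Icc u v)ᶜ = 0) {f : ℝ → ℝ} (hf : Continuous f) :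
    ∫ x, f x ∂P = (∫ x, f (ρ * x + t₁) ∂P + ∫ x, f (ρ * x + t₂) ∂P) / 2 := by
  have hi : ∀ t, Integrable f (P.map fun x => ρ * x + t) := fun t => by
    rw [integrable_map_measure hf.aestronglyMeasurable (by fun_prop)]
    exact integrable_of_continuous hs (by fun_prop)
  have h2 : (2 : ℝ≥0∞)⁻¹ ≠ ∞ := by simp
  conv_lhs => rw [hP]
  rw [integral_add_measure ((hi _).smul_measure h2) ((hi _).smul_measure h2),
    integral_smul_measure, integral_smul_measure,
    integral_map (by fun_prop) hf.aestronglyMeasurable,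
    integral_map (by fun_prop) hf.aestronglyMeasurable]
  simp only [ENNReal.toReal_inv, ENNReal.toReal_ofNat, smul_eq_mul]
  ring

lemma Quantizable.selfSimilar
    (hP : P = (2 : ℝ≥0∞)⁻¹ • P.map (fun x => ρ * x + t₁) +
      (2 : ℝ≥0∞)⁻¹ • P.map (fun x => ρ * x + t₂))
    (hs : P (Icc u v)ᶜ = 0) {n m : ℕ} {w z : ℝ} (hn : Quantizable P n w)
    (hm : Quantizable P m z) : Quantizable P (n + m) (ρ ^ 2 * ((w + z) / 2)) := by
  obtain ⟨γ, hγ, hc, hw⟩ := hn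
  obtain ⟨δ, hδ, hd, hz⟩ := hm
  set γ' := γ.image (fun c => ρ * c + t₁) with hγ'
  set δ' := δ.image (fun c => ρ * c + t₂) with hδ'
  have hne : (γ' ∪ δ').Nonempty := (hγ.image _).mono Finset.subset_union_left
  have cc := continuous_sqDist hne
  refine ⟨γ' ∪ δ', hne, (Finset.card_union_le _ _).trans
    (add_le_add (Finset.card_image_le.trans hc) (Finset.card_image_le.trans hd)), ?_⟩
  rw [integral_selfSimilar hP hs cc]
  have i1 : ∫ x, sqDist (γ' ∪ δ') (ρ * x + t₁) ∂P ≤ ∫ x, ρ ^ 2 * sqDist γ x ∂P := by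
    refine integral_mono (integrable_of_continuous hs (by fun_prop))
      ((integrable_of_continuous hs (continuous_sqDist hγ)).const_mul _) fun x => ?_
    exact (sqDist_anti (hγ.image _) Finset.subset_union_left _).trans_eq
      (sqDist_image_affine hγ _ _ _)
  have i2 : ∫ x, sqDist (γ' ∪ δ') (ρ * x + t₂) ∂P ≤ ∫ x, ρ ^ 2 * sqDist δ x ∂P := by
    refine integral_mono (integrable_of_continuous hs (by fun_prop))
      ((integrable_of_continuous hs (continuous_sqDist hδ)).const_mul _) fun x => ?_
    exact (sqDist_anti (hδ.image _) Finset.subset_union_right _).trans_eq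
      (sqDist_image_affine hδ _ _ _)
  rw [integral_const_mul] at i1 i2
  nlinarith [sq_nonneg ρ]

lemma Quantizable.selfSimilar_pow
    (hP : P = (2 : ℝ≥0∞)⁻¹ • P.map (fun x => ρ * x + t₁) +
      (2 : ℝ≥0∞)⁻¹ • P.map (fun x => ρ * x + t₂))
    (hs : P (Icc u v)ᶜ = 0) {n : ℕ} {w : ℝ} (hn : Quantizable P n w) (m : ℕ) :
    Quantizable P (n * 2 ^ m) ((ρ ^ 2) ^ m * w) := by
  induction m with
  | zero => simpa using hn
  | succ m ih =>
    have := ih.selfSimilar hP hs ih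
    convert this using 1 <;> rw [pow_succ] <;> ring

lemma isCantorMean_of_selfSimilar
    (hP : P = (2 : ℝ≥0∞)⁻¹ • P.map (fun x => 1 / 3 * x + 0) +
      (2 : ℝ≥0∞)⁻¹ • P.map (fun x => 1 / 3 * x + 2 / 9))
    (hs : P (Icc 0 (1 / 3))ᶜ = 0) : IsCantorMean fun f => ∫ x, f (3 * x) ∂P where
  mono f g hf hg hfg := by
    refine integral_mono_ae (integrable_of_continuous hs (by fun_prop))
      (integrable_of_continuous hs (by fun_prop)) ?_
    have hae : ∀ᵐ x ∂P, x ∈ Icc (0 : ℝ) (1 / 3) := hs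
    filter_upwards [hae] with x hx
    exact hfg _ ⟨by linarith [hx.1], by linarith [hx.2]⟩
  smul r f := integral_const_mul _ _
  selfSim f hf := by
    rw [integral_selfSimilar hP hs (f := fun x => f (3 * x)) (by fun_prop)]
    congr 3 <;> funext x <;> congr 1 <;> ring
  quad a b := by
    have ii : ∀ {f : ℝ → ℝ}, Continuous f → Integrable f P := integrable_of_continuous hs
    have q : ∀ p q r : ℝ, ∫ x, (p * x ^ 2 + q * x + r) ∂P =
        p * ∫ x, x ^ 2 ∂P + q * ∫ x, x ∂P + r := fun p q r => by
      rw [integral_add (ii (by fun_prop)) (ii (by fun_prop)),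
        integral_add (ii (by fun_prop)) (ii (by fun_prop)), integral_const_mul,
        integral_const_mul]
      simp
    have m1 : ∫ x, x ∂P = 1 / 6 := by
      have h := integral_selfSimilar hP hs (f := fun x => x) (by fun_prop)
      have e1 := q 0 (1 / 3) 0
      have e2 := q 0 (1 / 3) (2 / 9)
      simp only [zero_mul, zero_add] at e1 e2
      rw [e1, e2] at h
      linarith
    have m2 : ∫ x, x ^ 2 ∂P = 1 / 24 := by
      have h := integral_selfSimilar hP hs (f := fun x => x ^ 2) (by fun_prop)
      have e1 : ∀ x : ℝ, (1 / 3 * x + 0) ^ 2 = 1 / 9 * x ^ 2 + 0 * x + 0 := fun x => by ring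
      have e2 : ∀ x : ℝ, (1 / 3 * x + 2 / 9) ^ 2 = 1 / 9 * x ^ 2 + 4 / 27 * x + 4 / 81 :=
        fun x => by ring
      simp only [e1, e2, q, m1] at h
      linarith
    have e : ∀ x : ℝ, (a * (3 * x) + b) ^ 2 = 9 * a ^ 2 * x ^ 2 + 6 * a * b * x + b ^ 2 :=
      fun x => by ring
    simp only [e, q, m1, m2]
    ring

end SelfSimilar

lemma quantErr_le {P : Measure ℝ} {n : ℕ} {γ : Finset ℝ} (hγ : γ.Nonempty) (hn : γ.card ≤ n) :
    quantErr P n ≤ ∫ x, sqDist γ x ∂P := by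
  refine csInf_le ⟨0, ?_⟩ ⟨γ, hγ, hn, rfl⟩
  rintro _ ⟨δ, -, -, rfl⟩
  exact integral_nonneg fun x => sqDist_nonneg δ x

lemma le_quantErr {P : Measure ℝ} {n : ℕ} (hn : 1 ≤ n) {w : ℝ}
    (h : ∀ γ : Finset ℝ, γ.Nonempty → γ.card ≤ n → w ≤ ∫ x, sqDist γ x ∂P) :
    w ≤ quantErr P n := by
  refine le_csInf ⟨_, {0}, Finset.singleton_nonempty 0, by simpa using hn, rfl⟩ ?_
  rintro _ ⟨δ, h1, h2, rfl⟩
  exact h δ h1 h2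

lemma integral_mix {P₁ P₂ : Measure ℝ} {f : ℝ → ℝ} (h₁ : Integrable f P₁)
    (h₂ : Integrable f P₂) :
    ∫ x, f x ∂(mix P₁ P₂) = (∫ x, f x ∂P₁ + ∫ x, f x ∂P₂) / 2 := by
  have h2 : (2 : ℝ≥0∞)⁻¹ ≠ ∞ := by simp
  rw [mix, integral_add_measure (h₁.smul_measure h2) (h₂.smul_measure h2),
    integral_smul_measure, integral_smul_measure]
  simp only [ENNReal.toReal_inv, ENNReal.toReal_ofNat, smul_eq_mul]
  ring

lemma quantErr_mix_le {P₁ P₂ : Measure ℝ}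
    (h₁ : ∀ f : ℝ → ℝ, Continuous f → Integrable f P₁)
    (h₂ : ∀ f : ℝ → ℝ, Continuous f → Integrable f P₂) {n m : ℕ} {w z : ℝ}
    (hn : Quantizable P₁ n w) (hm : Quantizable P₂ m z) :
    quantErr (mix P₁ P₂) (n + m) ≤ (w + z) / 2 := by
  obtain ⟨γ, hγ, hc, hw⟩ := hn
  obtain ⟨δ, hδ, hd, hz⟩ := hm
  have hne : (γ ∪ δ).Nonempty := hγ.mono Finset.subset_union_left
  have cc := continuous_sqDist hne
  refine (quantErr_le hne ((Finset.card_union_le _ _).trans (add_le_add hc hd))).trans ?_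
  rw [integral_mix (h₁ _ cc) (h₂ _ cc)]
  have i1 : ∫ x, sqDist (γ ∪ δ) x ∂P₁ ≤ ∫ x, sqDist γ x ∂P₁ :=
    integral_mono (h₁ _ cc) (h₁ _ (continuous_sqDist hγ)) fun x =>
      sqDist_anti hγ Finset.subset_union_left x
  have i2 : ∫ x, sqDist (γ ∪ δ) x ∂P₂ ≤ ∫ x, sqDist δ x ∂P₂ :=
    integral_mono (h₂ _ cc) (h₂ _ (continuous_sqDist hδ)) fun x =>
      sqDist_anti hδ Finset.subset_union_right x
  linarith

lemma le_quantErr_mix {P₁ P₂ : Measure ℝ}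
    (h₁ : ∀ f : ℝ → ℝ, Continuous f → Integrable f P₁)
    (h₂ : ∀ f : ℝ → ℝ, Continuous f → Integrable f P₂)
    (hI : IsCantorMean fun f => ∫ x, f (3 * x) ∂P₁) {n : ℕ} (hn : 1 ≤ n) (k : ℕ) :
    (1 / 9) ^ k / 1296 * (17 - 8 * n / 2 ^ k) ≤ quantErr (mix P₁ P₂) n := by
  refine le_quantErr hn fun γ hγ hc => ?_
  have cc := continuous_sqDist hγ
  rw [integral_mix (h₁ _ cc) (h₂ _ cc)]
  have i2 : 0 ≤ ∫ x, sqDist γ x ∂P₂ := integral_nonneg fun x => sqDist_nonneg γ x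
  have i1 := hI.lower_bound k (γ.image fun c => 3 * c + 0) (hγ.image _)
  have e : ∀ x, sqDist (γ.image fun c => 3 * c + 0) (3 * x) = 3 ^ 2 * sqDist γ x := fun x => by
    rw [← sqDist_image_affine hγ 3 0 x, add_zero]
  simp only [e, integral_const_mul] at i1
  have hcard : ((γ.image fun c : ℝ => 3 * c + 0).card : ℝ) ≤ n := by
    exact_mod_cast Finset.card_image_le.trans hc
  have i3 : ((1 : ℝ) / 9) ^ k / 72 * (17 - 8 * n / 2 ^ k) ≤
      (1 / 9) ^ k / 72 * (17 - 8 * (γ.image fun c : ℝ => 3 * c + 0).card / 2 ^ k) := by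
    gcongr
  linarith

lemma tendsto_rpow_mul_of_bounds {θ r₀ C : ℝ} (hθ : (2 : ℝ) ^ θ = 9) (hr₀ : 0 < r₀)
    {N : ℕ → ℕ} {V r : ℕ → ℝ} (hN : ∀ m, (N m : ℝ) = 2 ^ (6 * m + 2) * r m)
    (hr : Tendsto r atTop (nhds r₀))
    (hl : ∀ m, (1 / 9) ^ (6 * m + 2) / 1296 * (17 - 8 * N m / 2 ^ (6 * m + 2)) ≤ V m)
    (hu : ∀ m, V m ≤ (1 / 9) ^ (6 * m + 2) * ((17 - 8 * r₀) / 1296) + C * (1 / 16) ^ (5 * m)) :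
    Tendsto (fun m => (N m : ℝ) ^ θ * V m) atTop (nhds ((17 - 8 * r₀) / 1296 * r₀ ^ θ)) := by
  have hW : Tendsto (fun m => 9 ^ (6 * m + 2) * V m) atTop (nhds ((17 - 8 * r₀) / 1296)) := by
    have h1 : Tendsto (fun m => (17 - 8 * r m) / 1296) atTop (nhds ((17 - 8 * r₀) / 1296)) :=
      ((hr.const_mul 8).const_sub 17).div_const _
    have h2 : Tendsto (fun m : ℕ => (17 - 8 * r₀) / 1296 + C * 81 * (531441 / 1048576) ^ m) atTop
        (nhds ((17 - 8 * r₀) / 1296)) := by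
      have := (tendsto_pow_atTop_nhds_zero_of_lt_one (r := (531441 / 1048576 : ℝ))
        (by norm_num) (by norm_num)).const_mul (C * 81) |>.const_add ((17 - 8 * r₀) / 1296)
      simpa using this
    have h9 : ∀ m : ℕ, (9 : ℝ) ^ (6 * m + 2) * (1 / 9) ^ (6 * m + 2) = 1 := fun m => by
      rw [← mul_pow]; norm_num
    refine tendsto_of_tendsto_of_tendsto_of_le_of_le h1 h2 (fun m => ?_) fun m => ?_
    · have := mul_le_mul_of_nonneg_left (hl m) (by positivity : (0 : ℝ) ≤ 9 ^ (6 * m + 2))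
      refine le_trans (le_of_eq ?_) this
      rw [hN, mul_left_comm 8, mul_div_cancel_left₀ _ (by positivity)]
      linear_combination (-(17 - 8 * r m) / 1296) * h9 m
    · have := mul_le_mul_of_nonneg_left (hu m) (by positivity : (0 : ℝ) ≤ 9 ^ (6 * m + 2))
      refine le_trans this (le_of_eq ?_)
      have e : (9 : ℝ) ^ (6 * m + 2) * (1 / 16) ^ (5 * m) = 81 * (531441 / 1048576) ^ m := by
        rw [pow_add, pow_mul, pow_mul, mul_right_comm, ← mul_pow]
        norm_num [mul_comm]
      linear_combination ((17 - 8 * r₀) / 1296) * h9 m + C * e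
  have hrθ : Tendsto (fun m => r m ^ θ) atTop (nhds (r₀ ^ θ)) :=
    hr.rpow_const (Or.inl hr₀.ne')
  refine (hW.mul hrθ).congr fun m => ?_
  have hr0 : 0 ≤ r m := by
    have h : (0 : ℝ) ≤ 2 ^ (6 * m + 2) * r m := hN m ▸ Nat.cast_nonneg _
    exact nonneg_of_mul_nonneg_right h (by positivity)
  rw [hN, Real.mul_rpow (by positivity) hr0, ← Real.rpow_natCast 2, ← Real.rpow_mul (by norm_num),
    mul_comm ((6 * m + 2 : ℕ) : ℝ), Real.rpow_mul (by norm_num), hθ, Real.rpow_natCast]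
  ring

theorem stmt19 (P₁ P₂ : Measure ℝ) [IsProbabilityMeasure P₁] [IsProbabilityMeasure P₂]
    (hP₁ : P₁ = (2 : ℝ≥0∞)⁻¹ • P₁.map (fun x => x / 3) +
      (2 : ℝ≥0∞)⁻¹ • P₁.map (fun x => x / 3 + 2/9))
    (hP₂ : P₂ = (2 : ℝ≥0∞)⁻¹ • P₂.map (fun x => x / 4 + 1/2) +
      (2 : ℝ≥0∞)⁻¹ • P₂.map (fun x => x / 4 + 3/4))
    (P : Measure ℝ) (hP : P = mix P₁ P₂)
    (β : ℝ) (hβ : β = Real.log 2 / Real.log 3)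
    (F G : ℕ → ℕ)
    (hF : ∀ n, F n = 2 ^ (6 * n - 4) + 2 ^ (5 * n - 4))
    (hG : ∀ n, G n = 2 ^ (6 * n - 4) + 2 ^ (6 * n - 5) + 2 ^ (5 * n - 3)) :
    Tendsto (fun n : ℕ => (F n : ℝ) ^ (2 / β) * quantErr P (F n)) atTop
      (nhds (1/144)) ∧
    Tendsto (fun n : ℕ => (G n : ℝ) ^ (2 / β) * quantErr P (G n)) atTop
      (nhds ((5/16) * (3 : ℝ) ^ (2 * Real.log 3 / Real.log 2 - 6))) ∧
    ¬ ∃ L : ℝ, Tendsto (fun n : ℕ => (n : ℝ) ^ (2 / β) * quantErr P n) atTop (nhds L) := by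
  have hP₁' : P₁ = (2 : ℝ≥0∞)⁻¹ • P₁.map (fun x => 1 / 3 * x + 0) +
      (2 : ℝ≥0∞)⁻¹ • P₁.map (fun x => 1 / 3 * x + 2 / 9) := by
    convert hP₁ using 4 <;> funext x <;> ring
  have hP₂' : P₂ = (2 : ℝ≥0∞)⁻¹ • P₂.map (fun x => 1 / 4 * x + 1 / 2) +
      (2 : ℝ≥0∞)⁻¹ • P₂.map (fun x => 1 / 4 * x + 3 / 4) := by
    convert hP₂ using 4 <;> funext x <;> ring
  have s₁ : P₁ (Icc 0 (1 / 3))ᶜ = 0 := measure_compl_Icc_eq_zero_of_selfSimilar hP₁'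
    (by norm_num) (by norm_num) (by norm_num) (by norm_num) (by norm_num) (by norm_num)
  have s₂ : P₂ (Icc (2 / 3) 1)ᶜ = 0 := measure_compl_Icc_eq_zero_of_selfSimilar hP₂'
    (by norm_num) (by norm_num) (by norm_num) (by norm_num) (by norm_num) (by norm_num)
  have i₁ : ∀ f : ℝ → ℝ, Continuous f → Integrable f P₁ :=
    fun f hf => integrable_of_continuous s₁ hf
  have i₂ : ∀ f : ℝ → ℝ, Continuous f → Integrable f P₂ :=
    fun f hf => integrable_of_continuous s₂ hf
  have hI := isCantorMean_of_selfSimilar hP₁' s₁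
  have q₁ : Quantizable P₁ 1 (1 / 72) := by
    have := quantizable_one (P := P₁) (1 / 6)
    have e := hI.quad (1 / 3) (-1 / 6)
    have e' : ∀ x : ℝ, (1 / 3 * (3 * x) + -1 / 6) ^ 2 = (x - 1 / 6) ^ 2 := fun x => by ring
    simp only [e'] at e
    rw [e] at this
    norm_num at this ⊢
    exact this
  have q₃ : Quantizable P₁ 3 (5 / 5832) := by
    have := q₁.selfSimilar hP₁' s₁ (q₁.selfSimilar hP₁' s₁ q₁)
    norm_num at this
    exact this
  obtain ⟨w, q₂⟩ : ∃ w, Quantizable P₂ 1 w := ⟨_, quantizable_one 0⟩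
  have hlog2 : 0 < Real.log 2 := Real.log_pos (by norm_num)
  have hθβ : 2 / β = 2 * Real.log 3 / Real.log 2 := by
    rw [hβ, div_div_eq_mul_div]
  rw [hθβ]
  set θ := 2 * Real.log 3 / Real.log 2 with hθdef
  have hθ : (2 : ℝ) ^ θ = 9 := by
    rw [Real.rpow_def_of_pos (by norm_num), hθdef, mul_div_cancel₀ _ hlog2.ne',
      show 2 * Real.log 3 = Real.log (3 ^ 2) by rw [Real.log_pow]; norm_num,
      Real.exp_log (by norm_num)]
    norm_num
  have hθ3 : 3 ≤ θ := by
    rw [hθdef, le_div_iff₀ hlog2]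
    have : Real.log (2 ^ 3) ≤ Real.log (3 ^ 2) := Real.log_le_log (by norm_num) (by norm_num)
    rw [Real.log_pow, Real.log_pow] at this
    exact_mod_cast this
  have hhalf : Tendsto (fun m : ℕ => (1 / 2 : ℝ) ^ m) atTop (nhds 0) :=
    tendsto_pow_atTop_nhds_zero_of_lt_one (by norm_num) (by norm_num)
  have hF' : ∀ m, F (m + 1) = 1 * 2 ^ (6 * m + 2) + 1 * 2 ^ (5 * m + 1) := fun m => by
    rw [hF, one_mul, one_mul]; congr 2
  have hG' : ∀ m, G (m + 1) = 3 * 2 ^ (6 * m + 1) + 1 * 2 ^ (5 * m + 2) := fun m => by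
    rw [hG, show 6 * (m + 1) - 4 = 6 * m + 1 + 1 by omega,
      show 6 * (m + 1) - 5 = 6 * m + 1 by omega, show 5 * (m + 1) - 3 = 5 * m + 2 by omega]
    ring
  have h2 : ∀ m : ℕ, (2 : ℝ) ^ m * (1 / 2) ^ m = 1 := fun m => by
    rw [← mul_pow]; norm_num
  have hFlim : Tendsto (fun n : ℕ => (F n : ℝ) ^ θ * quantErr P (F n)) atTop
      (nhds (1 / 144)) := by
    rw [← tendsto_add_atTop_iff_nat 1]
    have := tendsto_rpow_mul_of_bounds (r₀ := 1) (C := 1 / 32 * w) hθ (by norm_num)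
      (N := fun m => F (m + 1)) (V := fun m => quantErr P (F (m + 1)))
      (r := fun m => 1 + 1 / 2 * (1 / 2) ^ m) (fun m => by
        rw [hF']; push_cast
        linear_combination (-2 * 2 ^ (5 * m)) * h2 m)
      (by simpa only [mul_zero, add_zero] using (hhalf.const_mul (1 / 2)).const_add 1)
      (fun m => by
        rw [hP]
        refine le_quantErr_mix i₁ i₂ hI ?_ _
        have := Nat.one_le_two_pow (n := 6 * m + 2)
        rw [hF']
        omega)
      fun m => by
        have := quantErr_mix_le i₁ i₂ (q₁.selfSimilar_pow hP₁' s₁ (6 * m + 2))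
          (q₂.selfSimilar_pow hP₂' s₂ (5 * m + 1))
        rw [← hF', ← hP] at this
        refine this.trans (le_of_eq ?_)
        rw [pow_succ _ (5 * m)]
        norm_num
        ring
    norm_num at this ⊢
    exact this
  have hGlim : Tendsto (fun n : ℕ => (G n : ℝ) ^ θ * quantErr P (G n)) atTop
      (nhds (5 / 16 * (3 : ℝ) ^ (θ - 6))) := by
    rw [← tendsto_add_atTop_iff_nat 1]
    have := tendsto_rpow_mul_of_bounds (r₀ := 3 / 2) (C := 1 / 512 * w) hθ (by norm_num)
      (N := fun m => G (m + 1)) (V := fun m => quantErr P (G (m + 1)))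
      (r := fun m => 3 / 2 + (1 / 2) ^ m) (fun m => by
        rw [hG']; push_cast
        linear_combination (-4 * 2 ^ (5 * m)) * h2 m)
      (by simpa using hhalf.const_add (3 / 2))
      (fun m => by
        rw [hP]
        refine le_quantErr_mix i₁ i₂ hI ?_ _
        have := Nat.one_le_two_pow (n := 6 * m + 1)
        rw [hG']
        omega)
      fun m => by
        have := quantErr_mix_le i₁ i₂ (q₃.selfSimilar_pow hP₁' s₁ (6 * m + 1))
          (q₂.selfSimilar_pow hP₂' s₂ (5 * m + 2))
        rw [← hG', ← hP] at this
        refine this.trans (le_of_eq ?_)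
        rw [pow_add _ (5 * m), pow_succ _ (6 * m + 1)]
        norm_num
        ring
    convert this using 2
    rw [Real.div_rpow (by norm_num) (by norm_num), hθ, Real.rpow_sub (by norm_num)]
    norm_num
    ring
  refine ⟨hFlim, hGlim, ?_⟩
  rintro ⟨L, hL⟩
  have hFtop : Tendsto F atTop atTop := by
    rw [← tendsto_add_atTop_iff_nat 1]
    refine tendsto_atTop_mono (fun m => ?_) tendsto_id
    rw [hF']
    have : 6 * m + 2 < 2 ^ (6 * m + 2) := Nat.lt_two_pow_self
    simp only [id]
    omega
  have hGtop : Tendsto G atTop atTop := by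
    rw [← tendsto_add_atTop_iff_nat 1]
    refine tendsto_atTop_mono (fun m => ?_) tendsto_id
    rw [hG']
    have : 6 * m + 1 < 2 ^ (6 * m + 1) := Nat.lt_two_pow_self
    simp only [id]
    omega
  have hLF := tendsto_nhds_unique (hL.comp hFtop) hFlim
  have hLG := tendsto_nhds_unique (hL.comp hGtop) hGlim
  have h3 : (3 : ℝ) ^ (-3 : ℝ) ≤ 3 ^ (θ - 6) :=
    Real.rpow_le_rpow_of_exponent_le (by norm_num) (by linarith)
  rw [Real.rpow_neg (by norm_num)] at h3
  norm_num at h3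
  linarith
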